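/- Let q = p^e be a prime power, m a positive integer, and Tr : 𝔽_{q^m} → 𝔽_q the trace map. Let ℓ be a positive divisor of q^m − 1 and g(x) = x^r f(x^{(q^m−1)/ℓ}) ∈ 𝔽_{q^m}[x] a polynomial of index ℓ whose vanishing order at 0 is r with gcd(r, p) = 1. Let ζ ∈ 𝔽_{q^m} be a primitive ℓ-th root of unity and n₀ = #{ 0 ≤ i ≤ ℓ−1 : f(ζ^i) = 0 }. Let N be the number of pairs (x, y) ∈ 𝔽_{q^m}² satisfying y^q − y = g(x). Then | N − q^m − ((q−1)·q^m/ℓ)·n₀ | ≤ (q−1)(ℓ − n₀) · gcd(r, (q^m−1)/ℓ) · q^{m/2}. -/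

import Mathlib

open Polynomial Finset

lemma asib_root_count {K : Type*} [Field K] [Fintype K] [DecidableEq K]
    {M : ℕ} (hM : 0 < M) (c : K) : (univ.filter (fun x : K => x ^ M = c)).card ≤ M := by
  have h : (univ.filter (fun x : K => x ^ M = c)) ⊆ (nthRoots M c).toFinset := by
    intro x hx
    simp only [mem_filter, mem_univ, true_and] at hx
    simp [mem_nthRoots hM, hx]
  exact (card_le_card h).trans ((Multiset.toFinset_card_le _).trans (card_nthRoots M c))

lemma asib_pair_count {K : Type*} [Field K] [Fintype K] [DecidableEq K]
    {M r : ℕ} (hM : 0 < M) (x : K) (hx : x ≠ 0) :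
    (univ.filter (fun y : K => y ^ M = x ^ M ∧ y ^ r = x ^ r)).card ≤ Nat.gcd r M := by
  refine le_trans (card_le_card ?_) (asib_root_count (Nat.gcd_pos_of_pos_right r hM)
    (x ^ Nat.gcd r M))
  intro y hy
  simp only [mem_filter, mem_univ, true_and] at hy ⊢
  have h : (y / x) ^ Nat.gcd r M = 1 := by
    refine pow_gcd_eq_one.2 ⟨?_, ?_⟩
    · rw [div_pow, hy.2, div_self (pow_ne_zero _ hx)]
    · rw [div_pow, hy.1, div_self (pow_ne_zero _ hx)]
  rw [div_pow, div_eq_one_iff_eq (pow_ne_zero _ hx)] at h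
  exact h

lemma asib_partition {K : Type*} [Field K] [Fintype K] [DecidableEq K]
    {A : Type*} [AddCommMonoid A]
    {ℓ M : ℕ} (hℓ : 0 < ℓ) (hM : ℓ * M = Fintype.card K - 1)
    {ζ : K} (hζ : IsPrimitiveRoot ζ ℓ) (F : K → A) :
    ∑ x : K, F x = F 0 + ∑ i ∈ range ℓ, ∑ x ∈ univ.filter (fun x : K => x ^ M = ζ ^ i), F x := by
  have hQ : 1 < Fintype.card K := Fintype.one_lt_card
  have hM0 : M ≠ 0 := by rintro rfl; omega
  rw [← add_sum_erase univ F (mem_univ 0)]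
  congr 1
  rw [← sum_biUnion]
  · apply sum_congr _ (fun _ _ => rfl)
    ext x
    simp only [mem_erase, mem_univ, and_true, mem_biUnion, mem_range, mem_filter, true_and]
    constructor
    · intro hx
      haveI : NeZero ℓ := ⟨hℓ.ne'⟩
      have : (x ^ M) ^ ℓ = 1 := by
        rw [← pow_mul, mul_comm, hM]; exact FiniteField.pow_card_sub_one_eq_one x hx
      obtain ⟨i, hi, h⟩ := hζ.eq_pow_of_pow_eq_one this
      exact ⟨i, hi, h.symm⟩
    · rintro ⟨i, _, h⟩ rfl
      rw [zero_pow hM0] at h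
      exact pow_ne_zero i (hζ.ne_zero hℓ.ne') h.symm
  · intro i hi j hj hij
    simp only [Function.onFun]
    rw [disjoint_left]
    intro x hx hx'
    simp only [mem_filter, mem_univ, true_and] at hx hx'
    apply hij
    simp only [coe_range, Set.mem_Iio] at hi hj
    exact hζ.pow_inj hi hj (hx.symm.trans hx')

lemma asib_class_card {K : Type*} [Field K] [Fintype K] [DecidableEq K]
    {ℓ M : ℕ} (hℓ : 0 < ℓ) (hM : ℓ * M = Fintype.card K - 1)
    {ζ : K} (hζ : IsPrimitiveRoot ζ ℓ) {i : ℕ} (hi : i < ℓ) :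
    (univ.filter (fun x : K => x ^ M = ζ ^ i)).card = M := by
  have hQ : 1 < Fintype.card K := Fintype.one_lt_card
  have hM0 : 0 < M := by rcases Nat.eq_zero_or_pos M with rfl | h; · omega
                         · exact h
  have h := asib_partition hℓ hM hζ (fun _ => 1)
  simp only [← card_eq_sum_ones, card_univ] at h
  have h2 : ∑ i ∈ range ℓ, (univ.filter (fun x : K => x ^ M = ζ ^ i)).card = ∑ i ∈ range ℓ, M := by
    simp; omega
  exact (sum_eq_sum_iff_of_le (fun i _ => asib_root_count hM0 (ζ ^ i))).1 h2 i (by simpa using hi)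

lemma asib_moment {K : Type*} [Field K] [Fintype K] [DecidableEq K]
    (ψ : AddChar K ℂ) (hψ : ψ.IsPrimitive) {M r : ℕ} (hM : 0 < M) (t : ℝ) (c : K) (hc : c ≠ 0)
    (C : Finset K) (hC : C = univ.filter (fun x : K => x ^ M = c)) (hcard : C.card = M) :
    ∑ b : K, ‖(t : ℂ) + ∑ x ∈ C, ψ (b * x ^ r)‖ ^ 2 ≤
      (Fintype.card K : ℝ) * (t ^ 2 + M * Nat.gcd r M) := by
  have hC0 : ∀ x ∈ C, x ≠ 0 := by
    rintro x hx rfl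
    rw [hC] at hx
    simp only [mem_filter, mem_univ, true_and, zero_pow hM.ne'] at hx
    exact hc hx.symm
  have key : (∑ b : K, ((‖(t : ℂ) + ∑ x ∈ C, ψ (b * x ^ r)‖ ^ 2 : ℝ) : ℂ)) =
      (Fintype.card K : ℂ) * (t ^ 2 + ∑ x ∈ C, ((C.filter (fun y => y ^ r = x ^ r)).card : ℂ)) := by
    have e1 : ∀ b : K, ((‖(t : ℂ) + ∑ x ∈ C, ψ (b * x ^ r)‖ ^ 2 : ℝ) : ℂ) =
        t ^ 2 + t * ∑ x ∈ C, ψ (b * x ^ r) + t * ∑ x ∈ C, ψ (b * (- x ^ r)) +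
          ∑ x ∈ C, ∑ y ∈ C, ψ (b * (x ^ r - y ^ r)) := by
      intro b
      have : ∑ x ∈ C, ∑ y ∈ C, ψ (b * (x ^ r - y ^ r)) =
          (∑ x ∈ C, ψ (b * x ^ r)) * ∑ y ∈ C, ψ (b * (- y ^ r)) := by
        rw [sum_mul_sum]
        refine sum_congr rfl fun x _ => sum_congr rfl fun y _ => ?_
        rw [← AddChar.map_add_eq_mul]; congr 1; ring
      rw [this]
      have h2 : (starRingEnd ℂ) (∑ x ∈ C, ψ (b * x ^ r)) = ∑ y ∈ C, ψ (b * (- y ^ r)) := by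
        rw [map_sum]
        refine sum_congr rfl fun x _ => ?_
        rw [← AddChar.map_neg_eq_conj]; congr 1; ring
      push_cast
      rw [← Complex.mul_conj', map_add, h2, Complex.conj_ofReal]
      ring
    simp_rw [e1, sum_add_distrib, ← mul_sum]
    have z1 : ∑ b : K, ∑ x ∈ C, ψ (b * x ^ r) = 0 := by
      rw [sum_comm]
      refine sum_eq_zero fun x hx => ?_
      rw [AddChar.sum_mulShift _ hψ, if_neg (pow_ne_zero _ (hC0 x hx))]; simp
    have z2 : ∑ b : K, ∑ x ∈ C, ψ (b * (- x ^ r)) = 0 := by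
      rw [sum_comm]
      refine sum_eq_zero fun x hx => ?_
      rw [AddChar.sum_mulShift _ hψ, if_neg (neg_ne_zero.2 (pow_ne_zero _ (hC0 x hx)))]; simp
    have z3 : ∑ b : K, ∑ x ∈ C, ∑ y ∈ C, ψ (b * (x ^ r - y ^ r)) =
        (Fintype.card K : ℂ) * ∑ x ∈ C, ((C.filter (fun y => y ^ r = x ^ r)).card : ℂ) := by
      rw [sum_comm, mul_sum]
      refine sum_congr rfl fun x _ => ?_
      rw [sum_comm]
      have : ∀ y ∈ C, ∑ b : K, ψ (b * (x ^ r - y ^ r)) =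
          if y ^ r = x ^ r then (Fintype.card K : ℂ) else 0 := by
        intro y _
        rw [AddChar.sum_mulShift _ hψ]
        simp only [sub_eq_zero, eq_comm (a := x ^ r)]
        split_ifs <;> simp
      rw [sum_congr rfl this, ← sum_filter, sum_const, nsmul_eq_mul, mul_comm]
    rw [z1, z2, z3]
    simp
    ring
  have key2 : (∑ b : K, ‖(t : ℂ) + ∑ x ∈ C, ψ (b * x ^ r)‖ ^ 2) =
      (Fintype.card K : ℝ) * (t ^ 2 + ∑ x ∈ C, ((C.filter (fun y => y ^ r = x ^ r)).card : ℝ)) := by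
    exact_mod_cast key
  rw [key2]
  gcongr
  calc ∑ x ∈ C, ((C.filter (fun y => y ^ r = x ^ r)).card : ℝ)
      ≤ ∑ x ∈ C, (Nat.gcd r M : ℝ) := by
        refine sum_le_sum fun x hx => ?_
        rw [Nat.cast_le]
        refine le_trans (card_le_card ?_) (asib_pair_count hM x (hC0 x hx))
        intro y hy
        rw [hC] at hx hy
        simp only [mem_filter, mem_univ, true_and] at hx hy ⊢
        exact ⟨hy.1.trans hx.symm, hy.2⟩
    _ = M * Nat.gcd r M := by simp [hcard]

lemma asib_bound {K : Type*} [Field K] [Fintype K] [DecidableEq K]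
    (ψ : AddChar K ℂ) (hψ : ψ.IsPrimitive) {ℓ M r : ℕ} (hℓ : 0 < ℓ)
    (hM : ℓ * M = Fintype.card K - 1)
    {ζ : K} (hζ : IsPrimitiveRoot ζ ℓ) {i : ℕ} (hi : i < ℓ) (b : K) (hb : b ≠ 0) :
    ‖(1 / ℓ : ℂ) + ∑ x ∈ univ.filter (fun x : K => x ^ M = ζ ^ i), ψ (b * x ^ r)‖ ≤
      Nat.gcd r M * √(Fintype.card K : ℝ) := by
  have hQ : 1 < Fintype.card K := Fintype.one_lt_card
  have hM0 : 0 < M := by rcases Nat.eq_zero_or_pos M with rfl | h; · omega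
                         · exact h
  set C := univ.filter (fun x : K => x ^ M = ζ ^ i) with hC
  set C0 := univ.filter (fun x : K => x ^ M = 1) with hC0
  have hCcard : C.card = M := asib_class_card hℓ hM hζ hi
  have hC0card : C0.card = M := by
    have := asib_class_card hℓ hM hζ (i := 0) hℓ
    simpa using this
  set U : K → ℂ := fun b => ((1 / ℓ : ℝ) : ℂ) + ∑ x ∈ C, ψ (b * x ^ r) with hU
  have hmom : ∑ b : K, ‖U b‖ ^ 2 ≤ _ :=
    asib_moment (r := r) ψ hψ hM0 (1 / ℓ : ℝ) (ζ ^ i) (pow_ne_zero _ (hζ.ne_zero hℓ.ne')) C hC hCcard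
  have hv0 : ∀ v ∈ C0, v ≠ 0 := by
    rintro v hv rfl
    simp [hC0, zero_pow hM0.ne'] at hv
  have hinv : ∀ v ∈ C0, U (b * v ^ r) = U b := by
    intro v hv
    simp only [hU]
    congr 1
    have hv1 : v ^ M = 1 := by simpa [hC0] using hv
    refine sum_bij (fun x _ => v * x) ?_ ?_ ?_ ?_
    · intro x hx
      simp only [hC, mem_filter, mem_univ, true_and] at hx ⊢
      rw [mul_pow, hv1, hx, one_mul]
    · intro x _ y _ h
      exact mul_left_cancel₀ (hv0 v hv) h
    · intro y hy
      refine ⟨v⁻¹ * y, ?_, mul_inv_cancel_left₀ (hv0 v hv) y⟩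
      simp only [hC, mem_filter, mem_univ, true_and] at hy ⊢
      rw [mul_pow, inv_pow, hv1, hy, inv_one, one_mul]
    · intro x _
      congr 1; ring
  set d := Nat.gcd r M with hd
  have h0 : ‖U 0‖ ^ 2 = ((Fintype.card K : ℝ) / ℓ) ^ 2 := by
    have hl : (ℓ : ℝ) ≠ 0 := by positivity
    have : U 0 = (((Fintype.card K : ℝ) / ℓ : ℝ) : ℂ) := by
      simp only [hU, zero_mul, AddChar.map_zero_eq_one, sum_const, hCcard]
      have h3 : (ℓ : ℝ) * M + 1 = Fintype.card K := by
        have : ℓ * M + 1 = Fintype.card K := by omega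
        exact_mod_cast this
      rw [← h3]
      push_cast
      have hl : (ℓ : ℂ) ≠ 0 := by exact_mod_cast hℓ.ne'
      field_simp
      simp
      ring
    rw [this, Complex.norm_real, Real.norm_eq_abs, sq_abs]
  have hsum : (M : ℝ) * ‖U b‖ ^ 2 ≤ d * ∑ a ∈ univ.erase (0 : K), ‖U a‖ ^ 2 := by
    calc (M : ℝ) * ‖U b‖ ^ 2 = ∑ v ∈ C0, ‖U (b * v ^ r)‖ ^ 2 := by
          rw [sum_congr rfl (fun v hv => by rw [hinv v hv]), sum_const, hC0card, nsmul_eq_mul]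
      _ = ∑ a ∈ univ.erase (0 : K), ∑ v ∈ C0.filter (fun v => b * v ^ r = a),
            ‖U (b * v ^ r)‖ ^ 2 := by
          rw [sum_fiberwise_of_maps_to]
          intro v hv
          simp only [mem_erase, mem_univ, and_true]
          exact mul_ne_zero hb (pow_ne_zero _ (hv0 v hv))
      _ ≤ ∑ a ∈ univ.erase (0 : K), d * ‖U a‖ ^ 2 := by
          refine sum_le_sum fun a _ => ?_
          have : ∀ v ∈ C0.filter (fun v => b * v ^ r = a),
              ‖U (b * v ^ r)‖ ^ 2 = ‖U a‖ ^ 2 := by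
            intro v hv
            rw [(mem_filter.1 hv).2]
          rw [sum_congr rfl this, sum_const, nsmul_eq_mul]
          refine mul_le_mul_of_nonneg_right ?_ (by positivity)
          rw [Nat.cast_le]
          rcases (C0.filter (fun v => b * v ^ r = a)).eq_empty_or_nonempty with h | ⟨w, hw⟩
          · simp [h]
          · rw [mem_filter] at hw
            refine le_trans (card_le_card ?_) (asib_pair_count (r := r) hM0 w (hv0 w hw.1))
            intro v hv
            simp only [hC0, mem_filter, mem_univ, true_and] at hv hw ⊢
            exact ⟨hv.1.trans hw.1.symm, mul_left_cancel₀ hb (hv.2.trans hw.2.symm)⟩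
      _ = _ := by rw [mul_sum]
  rw [← add_sum_erase univ _ (mem_univ (0 : K)), h0] at hmom
  have hQ1 : (1 : ℝ) ≤ Fintype.card K := by exact_mod_cast hQ.le
  have hle : ∑ a ∈ univ.erase (0 : K), ‖U a‖ ^ 2 ≤ (Fintype.card K : ℝ) * (M * d) := by
    have : (Fintype.card K : ℝ) * (1 / ℓ : ℝ) ^ 2 ≤ ((Fintype.card K : ℝ) / ℓ) ^ 2 := by
      rw [div_pow, div_pow, one_pow, mul_one_div]
      gcongr
      nlinarith
    rw [mul_add] at hmom
    linarith
  have hMpos : (0 : ℝ) < M := by exact_mod_cast hM0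
  have hfin : ‖U b‖ ^ 2 ≤ (d : ℝ) ^ 2 * Fintype.card K := by
    have h4 : (d : ℝ) * ∑ a ∈ univ.erase (0 : K), ‖U a‖ ^ 2 ≤
      d * ((Fintype.card K : ℝ) * (M * d)) := by gcongr
    refine le_of_mul_le_mul_left ?_ hMpos
    linarith
  have hUb : (1 / ℓ : ℂ) + ∑ x ∈ C, ψ (b * x ^ r) = U b := by simp [hU]
  rw [hUb]
  refine abs_le_of_sq_le_sq' ?_ (by positivity) |>.2
  rw [mul_pow, Real.sq_sqrt (by positivity)]
  exact hfin

lemma asib_fixed_card {K : Type*} [Field K] [Fintype K] [DecidableEq K] {q : ℕ} (hq : 1 < q)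
    (h : q - 1 ∣ Fintype.card K - 1) :
    (univ.filter (fun y : K => y ^ q - y = 0)).card = q := by
  obtain ⟨k, hk⟩ := h
  obtain ⟨u, hu⟩ := IsCyclic.exists_ofOrder_eq_natCard (α := Kˣ)
  have hcard : Nat.card Kˣ = Fintype.card K - 1 := by
    rw [Nat.card_eq_fintype_card, Fintype.card_units]
  have hQ : 1 < Fintype.card K := Fintype.one_lt_card
  have hz : IsPrimitiveRoot (u : K) (Fintype.card K - 1) := by
    rw [← hcard, ← hu]
    exact IsPrimitiveRoot.coe_units_iff.2 (IsPrimitiveRoot.orderOf u)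
  have hz2 : IsPrimitiveRoot ((u : K) ^ (q - 1)) k := hz.pow (by omega) hk
  have hk0 : 0 < k := by rcases Nat.eq_zero_or_pos k with rfl | h; · omega
                         · exact h
  have h1 := asib_class_card hk0 (by rw [hk, mul_comm]) hz2 (i := 0) hk0
  rw [pow_zero] at h1
  have h2 : (univ.filter (fun y : K => y ^ q - y = 0)) =
      insert 0 (univ.filter (fun y : K => y ^ (q - 1) = 1)) := by
    ext y
    simp only [mem_filter, mem_univ, true_and, mem_insert]
    have : y ^ q - y = y * (y ^ (q - 1) - 1) := by
      rw [mul_sub, mul_one, ← pow_succ', Nat.sub_add_cancel hq.le]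
    rw [this, mul_eq_zero, sub_eq_zero]
  rw [h2, card_insert_of_notMem, h1]
  · omega
  · simp [zero_pow (show q - 1 ≠ 0 by omega)]

/-- Point counts of `L y = c` via characters. -/
lemma asib_count {K : Type*} [Field K] [Fintype K] [DecidableEq K]
    (ψ : AddChar K ℂ) (hψ : ψ.IsPrimitive) (L : K →+ K) :
    ∃ A : Finset K, (0 : K) ∈ A ∧ A.card = (univ.filter (fun y => L y = 0)).card ∧
      ∀ c, ((univ.filter (fun y => L y = c)).card : ℂ) = ∑ b ∈ A, ψ (b * -c) := by
  classical
  have hQ : (Fintype.card K : ℂ) ≠ 0 := by exact_mod_cast Fintype.card_ne_zero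
  let φ : K → AddChar K ℂ := fun b => (ψ.mulShift b).compAddMonoidHom L
  let A : Finset K := univ.filter (fun b => φ b = 0)
  have hmain : ∀ c, ((univ.filter (fun y => L y = c)).card : ℂ) = ∑ b ∈ A, ψ (b * -c) := by
    intro c
    apply mul_left_cancel₀ hQ
    have h1 : ∑ y : K, ∑ b : K, ψ (b * (L y - c)) =
        (Fintype.card K : ℂ) * ((univ.filter (fun y => L y = c)).card : ℂ) := by
      simp_rw [AddChar.sum_mulShift _ hψ, sub_eq_zero]
      push_cast
      rw [← sum_filter, sum_const, nsmul_eq_mul, mul_comm]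
    rw [← h1, sum_comm, mul_sum, sum_filter]
    refine sum_congr rfl fun b _ => ?_
    have : ∀ y, ψ (b * (L y - c)) = φ b y * ψ (b * -c) := by
      intro y
      simp only [φ, AddChar.compAddMonoidHom_apply, AddChar.mulShift_apply]
      rw [← AddChar.map_add_eq_mul]; congr 1; ring
    simp_rw [this, ← sum_mul, AddChar.sum_eq_ite]
    split_ifs <;> simp
  refine ⟨A, ?_, ?_, hmain⟩
  · simp only [A, mem_filter, mem_univ, true_and]
    ext y
    simp [φ]
  · have := hmain 0
    simp at this
    exact_mod_cast this.symm

theorem artin_schreier_index_bound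
    {p e m : ℕ} (hp : p.Prime) (he : 0 < e) (hm : 0 < m)
    {K : Type*} [Field K] [Fintype K] [DecidableEq K]
    (hK : Fintype.card K = p ^ (e * m))
    (ℓ : ℕ) (hℓ : 0 < ℓ) (hℓdvd : ℓ ∣ p ^ (e * m) - 1)
    (r : ℕ) (hrp : Nat.gcd r p = 1)
    (f : K[X]) (g : K[X])
    (hg : g = X ^ r * f.comp (X ^ ((p ^ (e * m) - 1) / ℓ)))
    (hf0 : f.coeff 0 ≠ 0)
    (hidx : Nat.gcd ((f.support.erase 0).gcd id) ℓ = 1)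
    (ζ : K) (hζ : IsPrimitiveRoot ζ ℓ)
    (n₀ : ℕ)
    (hn₀ : n₀ = ((Finset.range ℓ).filter (fun i => f.eval (ζ ^ i) = 0)).card)
    (N : ℕ)
    (hN : N = (Finset.univ.filter
      (fun xy : K × K => xy.2 ^ (p ^ e) - xy.2 = g.eval xy.1)).card) :
    |(N : ℝ) - (p : ℝ) ^ (e * m)
        - ((p : ℝ) ^ e - 1) * (p : ℝ) ^ (e * m) / (ℓ : ℝ) * (n₀ : ℝ)| ≤
      ((p : ℝ) ^ e - 1) * ((ℓ : ℝ) - (n₀ : ℝ)) *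
        (Nat.gcd r ((p ^ (e * m) - 1) / ℓ) : ℝ) *
        Real.sqrt ((p : ℝ) ^ (e * m)) := by
  haveI : Fact p.Prime := ⟨hp⟩
  haveI : CharP K p := charP_of_card_eq_prime_pow hK
  set M := (p ^ (e * m) - 1) / ℓ with hMdef
  have hM : ℓ * M = Fintype.card K - 1 := by rw [hK]; exact Nat.mul_div_cancel' hℓdvd
  have hQ : 1 < Fintype.card K := Fintype.one_lt_card
  have hr : r ≠ 0 := by
    rintro rfl
    rw [Nat.gcd_zero_left] at hrp
    exact hp.one_lt.ne' hrp
  have hq : 1 < p ^ e := Nat.one_lt_pow he.ne' hp.one_lt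
  set ψ := AddChar.FiniteField.primitiveChar_to_Complex K with hψdef
  have hψ : ψ.IsPrimitive := AddChar.FiniteField.primitiveChar_to_Complex_isPrimitive K
  let L : K →+ K :=
    { toFun := fun y => y ^ (p ^ e) - y
      map_zero' := by simp [hp.ne_zero]
      map_add' := fun x y => by rw [add_pow_char_pow]; ring }
  obtain ⟨A, hA0, hAcard, hA⟩ := asib_count ψ hψ L
  have hAq : A.card = p ^ e := by
    rw [hAcard]
    refine asib_fixed_card hq ?_
    rw [hK, pow_mul]
    exact Nat.sub_one_dvd_pow_sub_one _ _
  have hgx : ∀ x : K, g.eval x = x ^ r * f.eval (x ^ M) := by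
    intro x; rw [hg]; simp
  -- N as a character sum
  have hNsum : (N : ℂ) = ∑ b ∈ A, ∑ x : K, ψ (b * -g.eval x) := by
    rw [sum_comm, hN]
    have : (Finset.univ.filter
        (fun xy : K × K => xy.2 ^ (p ^ e) - xy.2 = g.eval xy.1)).card =
        ∑ x : K, (univ.filter (fun y => L y = g.eval x)).card := by
      simp only [card_filter]
      rw [Fintype.sum_prod_type]
      rfl
    rw [this]
    push_cast
    exact sum_congr rfl fun x _ => hA _
  set Z := (range ℓ).filter (fun i => f.eval (ζ ^ i) = 0) with hZ
  set Y := (range ℓ).filter (fun i => ¬ f.eval (ζ ^ i) = 0) with hY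
  have hYcard : Y.card + n₀ = ℓ := by
    rw [hn₀, add_comm, hY, hZ, card_filter_add_card_filter_not, card_range]
  let U : K → ℕ → ℂ := fun b i => (1 / ℓ : ℂ) +
    ∑ x ∈ univ.filter (fun x : K => x ^ M = ζ ^ i), ψ (b * x ^ r)
  have hlC : (ℓ : ℂ) ≠ 0 := by exact_mod_cast hℓ.ne'
  have hQC : (ℓ : ℂ) * M + 1 = Fintype.card K := by
    have : ℓ * M + 1 = Fintype.card K := by omega
    exact_mod_cast this
  have hYC : (Y.card : ℂ) + n₀ = ℓ := by exact_mod_cast hYcard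
  have hinner : ∀ b : K, ∑ x : K, ψ (b * -g.eval x) =
      (Fintype.card K : ℂ) / ℓ * n₀ + ∑ i ∈ Y, U (-b * f.eval (ζ ^ i)) i := by
    intro b
    rw [asib_partition hℓ hM hζ]
    have h0 : ψ (b * -g.eval 0) = 1 := by
      rw [hgx, zero_pow hr]; simp
    rw [h0, ← sum_filter_add_sum_filter_not (range ℓ) (fun i => f.eval (ζ ^ i) = 0)]
    have hz : ∑ i ∈ Z, ∑ x ∈ univ.filter (fun x : K => x ^ M = ζ ^ i), ψ (b * -g.eval x) =
        n₀ * M := by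
      rw [hn₀, ← nsmul_eq_mul, ← sum_const]
      refine sum_congr rfl fun i hi => ?_
      rw [hZ, mem_filter, mem_range] at hi
      have : ∀ x ∈ univ.filter (fun x : K => x ^ M = ζ ^ i), ψ (b * -g.eval x) = 1 := by
        intro x hx
        simp only [mem_filter, mem_univ, true_and] at hx
        rw [hgx, hx, hi.2]; simp
      rw [sum_congr rfl this, sum_const, asib_class_card hℓ hM hζ hi.1]; simp
    have hy : ∑ i ∈ Y, ∑ x ∈ univ.filter (fun x : K => x ^ M = ζ ^ i), ψ (b * -g.eval x) =
        ∑ i ∈ Y, U (-b * f.eval (ζ ^ i)) i - Y.card / ℓ := by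
      simp only [U]
      rw [sum_add_distrib, sum_const, nsmul_eq_mul, mul_one_div, add_sub_cancel_left]
      refine sum_congr rfl fun i hi => sum_congr rfl fun x hx => ?_
      simp only [mem_filter, mem_univ, true_and] at hx
      rw [hgx, hx]; congr 1; ring
    rw [hz, hy, ← hQC]
    have : (Y.card : ℂ) = ℓ - n₀ := by rw [← hYC]; ring
    rw [this]
    field_simp
    ring
  have hE : (((N : ℝ) - (p : ℝ) ^ (e * m)
        - ((p : ℝ) ^ e - 1) * (p : ℝ) ^ (e * m) / (ℓ : ℝ) * (n₀ : ℝ) : ℝ) : ℂ) =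
      ∑ b ∈ A.erase 0, ∑ i ∈ Y, U (-b * f.eval (ζ ^ i)) i := by
    have hcA : ((A.erase 0).card : ℂ) = (p : ℂ) ^ e - 1 := by
      rw [card_erase_of_mem hA0, hAq, Nat.cast_sub hq.le]; push_cast; rfl
    push_cast
    rw [hNsum, ← add_sum_erase A _ hA0]
    rw [sum_congr (rfl : A.erase 0 = A.erase 0) (fun b _ => hinner b), sum_add_distrib, sum_const,
      nsmul_eq_mul, hcA]
    have hKC : (Fintype.card K : ℂ) = (p : ℂ) ^ (e * m) := by rw [hK]; push_cast; rfl
    simp [hKC]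
    ring
  rw [← Real.norm_eq_abs, ← Complex.norm_real, hE]
  have hKR : (Fintype.card K : ℝ) = (p : ℝ) ^ (e * m) := by rw [hK]; push_cast; rfl
  rw [← hKR]
  have hcA : ((A.erase 0).card : ℝ) = (p : ℝ) ^ e - 1 := by
    rw [card_erase_of_mem hA0, hAq, Nat.cast_sub hq.le]; push_cast; rfl
  have hYR : (Y.card : ℝ) = ℓ - n₀ := by
    have : (Y.card : ℝ) + n₀ = ℓ := by exact_mod_cast hYcard
    linarith
  calc ‖∑ b ∈ A.erase 0, ∑ i ∈ Y, U (-b * f.eval (ζ ^ i)) i‖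
      ≤ ∑ b ∈ A.erase 0, ∑ i ∈ Y, (Nat.gcd r M * √(Fintype.card K : ℝ)) := by
        refine norm_sum_le_of_le _ fun b hb => norm_sum_le_of_le _ fun i hi => ?_
        rw [hY, mem_filter, mem_range] at hi
        exact asib_bound ψ hψ hℓ hM hζ hi.1 _
          (mul_ne_zero (neg_ne_zero.2 (ne_of_mem_erase hb)) hi.2)
    _ = _ := by
        rw [sum_const, sum_const, nsmul_eq_mul, nsmul_eq_mul, hcA, hYR]; ring
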